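/- For every integer k ≥ 4, the maximum cardinality of a partial k-spread in 𝔽_2^{2k+2} equals 2^{k+2} + 1. -/

import Mathlib

/-- A partial `k`-spread in `𝔽_2^n`: a set of `k`-dimensional subspaces
any two distinct members of which intersect trivially. -/
def IsPartialSpread {n : ℕ} (k : ℕ)
    (S : Finset (Submodule (ZMod 2) (Fin n → ZMod 2))) : Prop :=
  (∀ U ∈ S, Module.finrank (ZMod 2) U = k) ∧
  ∀ U ∈ S, ∀ V ∈ S, U ≠ V → U ⊓ V = ⊥

open Classical in
/-- The nonzero vectors not covered by any member of `T`. -/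
noncomputable def holes {n : ℕ} (T : Finset (Submodule (ZMod 2) (Fin n → ZMod 2))) :
    Finset (Fin n → ZMod 2) :=
  Finset.univ.filter fun v => v ≠ 0 ∧ ∀ U ∈ T, v ∉ U

open Classical in
/-- The vectors of a subspace, as a finset. -/
noncomputable def pts {n : ℕ} (W : Submodule (ZMod 2) (Fin n → ZMod 2)) :
    Finset (Fin n → ZMod 2) :=
  Finset.univ.filter fun v => v ∈ W

lemma card_pts {n : ℕ} (W : Submodule (ZMod 2) (Fin n → ZMod 2)) :
    (pts W).card = 2 ^ Module.finrank (ZMod 2) W := by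
  classical
  have h := Module.card_eq_pow_finrank (K := ZMod 2) (V := W)
  rw [ZMod.card] at h
  rw [← h, pts, Fintype.card_subtype]

open Classical in
lemma count_holes {n k : ℕ} {T : Finset (Submodule (ZMod 2) (Fin n → ZMod 2))}
    (hT : IsPartialSpread k T) (W : Submodule (ZMod 2) (Fin n → ZMod 2)) :
    ((holes T).filter fun v => v ∈ W).card + ∑ U ∈ T, (pts (U ⊓ W)).card + 1
      = (pts W).card + T.card := by
  have key : ∀ v : Fin n → ZMod 2,
      (if v ≠ 0 ∧ ∀ U ∈ T, v ∉ U then 1 else 0) + ∑ U ∈ T, (if v ∈ U then 1 else 0)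
        + (if v = 0 then 1 else 0) = 1 + (if v = 0 then T.card else 0) := by
    intro v
    by_cases hv : v = 0
    · subst hv
      simp
      omega
    · by_cases h : ∀ U ∈ T, v ∉ U
      · rw [Finset.sum_eq_zero (fun U hU => if_neg (h U hU))]
        simp only [hv, ne_eq, not_false_eq_true, true_and, if_false]
        simp [if_pos h]
      · push Not at h
        obtain ⟨U, hU, hvU⟩ := h
        rw [Finset.sum_eq_single U, if_pos hvU, if_neg]
        · simp [hv]
        · rintro ⟨_, h⟩
          exact h U hU hvU
        · intro U' hU' hne
          rw [if_neg]
          intro hv'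
          have := hT.2 U' hU' U hU hne
          have h2 : v ∈ U' ⊓ U := ⟨hv', hvU⟩
          rw [this] at h2
          exact hv (by simpa using h2)
        · intro h; exact absurd hU h
  have hs := Finset.sum_congr (rfl : pts W = pts W) (fun v _ => key v)
  simp only [Finset.sum_add_distrib] at hs
  rw [Finset.sum_comm] at hs
  have h0 : (0 : Fin n → ZMod 2) ∈ pts W := by simp [pts]
  rw [Finset.sum_ite_eq' , Finset.sum_ite_eq', if_pos h0, if_pos h0] at hs
  simp only [← Finset.card_filter, ← Finset.card_eq_sum_ones] at hs
  rw [← hs]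
  congr 2
  · congr 1
    ext v
    simp [holes, pts, and_comm]
  · refine Finset.sum_congr rfl fun U _ => ?_
    congr 1
    ext v
    simp [pts, and_comm]

open Classical in
lemma holes_mod {n k j : ℕ} {T : Finset (Submodule (ZMod 2) (Fin n → ZMod 2))}
    (hT : IsPartialSpread k T) (hc : T.card = 2 ^ (k + 2) + 2) (hkn : k ≤ n)
    (W : Submodule (ZMod 2) (Fin n → ZMod 2))
    (hW : n ≤ Module.finrank (ZMod 2) W + j) :
    ∃ m : ℤ, (((holes T).filter fun v => v ∈ W).card : ℤ) = 1 + 2 ^ (k - j) * m := by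
  have h := count_holes hT W
  have h1 : 2 ^ (k - j) ∣ (pts W).card := by
    rw [card_pts]; exact pow_dvd_pow _ (by omega)
  have h2 : 2 ^ (k - j) ∣ ∑ U ∈ T, (pts (U ⊓ W)).card := by
    refine Finset.dvd_sum fun U hU => ?_
    rw [card_pts]
    refine pow_dvd_pow _ ?_
    have a := Submodule.finrank_sup_add_finrank_inf_eq U W
    have b := Submodule.finrank_le (U ⊔ W)
    have c := hT.1 U hU
    simp only [Module.finrank_fin_fun] at b
    omega
  have h3 : 2 ^ (k - j) ∣ 2 ^ (k + 2) := pow_dvd_pow _ (by omega)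
  obtain ⟨a, ha⟩ := h1
  obtain ⟨b, hb⟩ := h2
  obtain ⟨c, hc'⟩ := h3
  rw [ha, hb, hc, hc'] at h
  refine ⟨a + c - b, ?_⟩
  have h' := congrArg (Nat.cast : ℕ → ℤ) h
  push_cast at h'
  linarith

open Classical in
/-- Some hyperplane section contains less than half of a nonempty set of nonzero vectors. -/
lemma exists_section {n : ℕ} (N : Finset (Fin n → ZMod 2)) (hN : N.Nonempty) (h0 : 0 ∉ N) :
    ∃ f : (Fin n → ZMod 2) →ₗ[ZMod 2] ZMod 2,
      2 * (N.filter fun v => v ∈ LinearMap.ker f).card < N.card := by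
  by_contra! hcon
  let φ : (Fin n → ZMod 2) → ((Fin n → ZMod 2) →ₗ[ZMod 2] ZMod 2) :=
    fun a => ∑ i, a i • LinearMap.proj i
  have hφ : ∀ a v, φ a v = ∑ i, a i * v i := by intro a v; simp [φ]
  have half : ∀ v ∈ N, 2 * (Finset.univ.filter fun a => φ a v = 0).card
      = Fintype.card (Fin n → ZMod 2) := by
    intro v hv
    have hv0 : v ≠ 0 := fun h => h0 (h ▸ hv)
    obtain ⟨i, hi⟩ := Function.ne_iff.mp hv0
    have hi1 : v i = 1 := by
      have : ∀ x : ZMod 2, x ≠ 0 → x = 1 := by decide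
      exact this _ hi
    have hadd : ∀ a, φ (a + Pi.single i 1) v = φ a v + 1 := by
      intro a
      simp [hφ, add_mul, Finset.sum_add_distrib, Pi.single_apply, hi1]
    have z2 : ∀ x : ZMod 2, x + x = 0 := by decide
    have hinv : ∀ a : Fin n → ZMod 2, a + Pi.single i 1 + Pi.single i 1 = a := by
      intro a
      rw [add_assoc]
      ext j
      simp [z2]
    have hbij : (Finset.univ.filter fun a => φ a v = 0).card
        = (Finset.univ.filter fun a => ¬ φ a v = 0).card := by
      refine Finset.card_bij' (fun a _ => a + Pi.single i 1) (fun a _ => a + Pi.single i 1)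
        ?_ ?_ ?_ ?_
      · intro a ha
        simp only [Finset.mem_filter, Finset.mem_univ, true_and] at ha ⊢
        rw [hadd, ha]; decide
      · intro a ha
        simp only [Finset.mem_filter, Finset.mem_univ, true_and] at ha ⊢
        rw [hadd]
        have : ∀ x : ZMod 2, x ≠ 0 → x + 1 = 0 := by decide
        exact this _ ha
      · intro a _; exact hinv a
      · intro a _; exact hinv a
    have := Finset.card_filter_add_card_filter_not (s := Finset.univ) (fun a => φ a v = 0)
    rw [← hbij, Finset.card_univ] at this
    omega
  have dc : ∑ a, (N.filter fun v => v ∈ LinearMap.ker (φ a)).card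
      = ∑ v ∈ N, (Finset.univ.filter fun a => φ a v = 0).card := by
    simp only [Finset.card_filter, LinearMap.mem_ker]
    exact Finset.sum_comm
  have tot : ∑ a, 2 * (N.filter fun v => v ∈ LinearMap.ker (φ a)).card
      = ∑ _a : Fin n → ZMod 2, N.card := by
    rw [← Finset.mul_sum, dc, Finset.mul_sum, Finset.sum_congr rfl half]
    simp [mul_comm]
  have lt : ∑ _a : Fin n → ZMod 2, N.card <
      ∑ a, 2 * (N.filter fun v => v ∈ LinearMap.ker (φ a)).card := by
    refine Finset.sum_lt_sum (fun a _ => hcon (φ a)) ⟨0, Finset.mem_univ _, ?_⟩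
    have : (N.filter fun v => v ∈ LinearMap.ker (φ 0)) = N := by
      apply Finset.filter_true_of_mem
      intro v _
      simp [hφ]
    rw [this]
    have := hN.card_pos
    omega
  omega

open Classical in
lemma step {n k j : ℕ} {T : Finset (Submodule (ZMod 2) (Fin n → ZMod 2))}
    (hT : IsPartialSpread k T) (hc : T.card = 2 ^ (k + 2) + 2) (hkn : k ≤ n)
    (W : Submodule (ZMod 2) (Fin n → ZMod 2))
    (hW : n ≤ Module.finrank (ZMod 2) W + j)
    (hne : 0 < ((holes T).filter fun v => v ∈ W).card) :
    ∃ W' : Submodule (ZMod 2) (Fin n → ZMod 2),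
      n ≤ Module.finrank (ZMod 2) W' + (j + 1) ∧
      2 * ((holes T).filter fun v => v ∈ W').card < ((holes T).filter fun v => v ∈ W).card ∧
      ∃ m : ℤ, (((holes T).filter fun v => v ∈ W').card : ℤ) = 1 + 2 ^ (k - (j + 1)) * m := by
  obtain ⟨f, hf⟩ := exists_section _ (Finset.card_pos.mp hne) (by simp [holes])
  have hd : n ≤ Module.finrank (ZMod 2) (W ⊓ LinearMap.ker f : Submodule _ _) + (j + 1) := by
    have a := Submodule.finrank_sup_add_finrank_inf_eq W (LinearMap.ker f)
    have b := Submodule.finrank_le (W ⊔ LinearMap.ker f)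
    have c := LinearMap.finrank_range_add_finrank_ker f
    have d := Submodule.finrank_le (LinearMap.range f)
    simp only [Module.finrank_fin_fun, Module.finrank_self] at b c d
    omega
  refine ⟨W ⊓ LinearMap.ker f, hd, ?_, holes_mod hT hc hkn _ hd⟩
  rw [Finset.filter_filter] at hf
  simpa only [Submodule.mem_inf] using hf

lemma no_big (k : ℕ) (hk : 4 ≤ k) (T : Finset (Submodule (ZMod 2) (Fin (2 * k + 2) → ZMod 2)))
    (hT : IsPartialSpread k T) (hc : T.card = 2 ^ (k + 2) + 2) : False := by
  classical
  have h0 : ((holes T).filter fun v => v ∈ (⊤ : Submodule (ZMod 2) _)).card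
      = 2 ^ (k + 1) + 1 := by
    have h := count_holes hT ⊤
    have e : ∑ U ∈ T, (pts (U ⊓ ⊤)).card = T.card * 2 ^ k := by
      refine Finset.sum_const_nat fun U hU => ?_
      rw [inf_top_eq, card_pts, hT.1 U hU]
    rw [e, card_pts, finrank_top, Module.finrank_fin_fun, hc] at h
    have e1 : 2 ^ (2 * k + 2) = 4 * (2 ^ k * 2 ^ k) := by ring
    have e2 : (2 ^ (k + 2) + 2) * 2 ^ k = 4 * (2 ^ k * 2 ^ k) + 2 * 2 ^ k := by ring
    have e3 : 2 ^ (k + 2) = 4 * 2 ^ k := by ring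
    have e4 : 2 ^ (k + 1) = 2 * 2 ^ k := by ring
    omega
  obtain ⟨W1, d1, l1, m1, hm1⟩ := step (j := 0) hT hc (by omega) ⊤ (by simp) (by rw [h0]; positivity)
  rw [h0] at l1
  obtain ⟨p, rfl⟩ := Nat.exists_eq_add_of_le hk
  have q1 : 4 + p - (0 + 1) = p + 3 := by omega
  have q2 : 4 + p - (0 + 1 + 1) = p + 2 := by omega
  have q3 : 4 + p - (0 + 1 + 1 + 1) = p + 1 := by omega
  have pp : (0 : ℤ) < 2 ^ p := by positivity
  rw [q1] at hm1
  have m1lt : m1 < 2 := by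
    zify at l1
    by_contra! hcon
    have : (2 : ℤ) ^ (p + 3) * 2 ≤ 2 ^ (p + 3) * m1 := by gcongr
    ring_nf at *
    omega
  have m1le : (2 : ℤ) ^ (p + 3) * m1 ≤ 2 ^ (p + 3) * 1 := by
    have : m1 ≤ 1 := by omega
    gcongr
  have m1pos : 0 ≤ m1 := by
    by_contra! hcon
    have : (2 : ℤ) ^ (p + 3) * m1 ≤ 2 ^ (p + 3) * (-1) := by
      have : m1 ≤ -1 := by omega
      gcongr
    ring_nf at *
    omega
  have m1nn : 0 ≤ (2 : ℤ) ^ (p + 3) * m1 := by positivity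
  obtain ⟨W2, d2, l2, m2, hm2⟩ := step hT hc (by omega) W1 d1 (by omega)
  rw [q2] at hm2
  have m2le : m2 ≤ 0 := by
    zify at l2
    by_contra! hcon
    have : (2 : ℤ) ^ (p + 2) * 1 ≤ 2 ^ (p + 2) * m2 := by gcongr; omega
    ring_nf at *
    omega
  have m2pos : 0 ≤ m2 := by
    by_contra! hcon
    have : (2 : ℤ) ^ (p + 2) * m2 ≤ 2 ^ (p + 2) * (-1) := by
      have : m2 ≤ -1 := by omega
      gcongr
    ring_nf at *
    omega
  obtain rfl : m2 = 0 := by omega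
  obtain ⟨W3, d3, l3, m3, hm3⟩ := step hT hc (by omega) W2 d2 (by omega)
  rw [q3, pow_succ, mul_comm _ (2 : ℤ), mul_assoc] at hm3
  omega

lemma exists_spread (k : ℕ) (hk : 4 ≤ k) :
    ∃ S : Finset (Submodule (ZMod 2) (Fin (2 * k + 2) → ZMod 2)),
      IsPartialSpread k S ∧ S.card = 2 ^ (k + 2) + 1 := by
  classical
  let L := GaloisField 2 (k + 2)
  have hL : Module.finrank (ZMod 2) L = k + 2 := GaloisField.finrank 2 (by omega)
  have : Fintype L := Fintype.ofFinite L
  have cL : Fintype.card L = 2 ^ (k + 2) := by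
    have h := Module.card_eq_pow_finrank (K := ZMod 2) (V := L)
    rwa [ZMod.card, hL] at h
  let e : ((Fin 2 → ZMod 2) × (Fin k → ZMod 2)) ≃ₗ[ZMod 2] L :=
    LinearEquiv.ofFinrankEq _ _ (by simp [hL]; omega)
  let ι : (Fin k → ZMod 2) →ₗ[ZMod 2] L := e.toLinearMap ∘ₗ LinearMap.inr _ _ _
  have hι : Function.Injective ι := e.injective.comp LinearMap.inr_injective
  let φ : ((Fin k → ZMod 2) × L) ≃ₗ[ZMod 2] (Fin (2 * k + 2) → ZMod 2) :=
    LinearEquiv.ofFinrankEq _ _ (by simp [hL]; omega)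
  let g : Option L → ((Fin k → ZMod 2) →ₗ[ZMod 2] (Fin (2 * k + 2) → ZMod 2)) := fun o =>
    φ.toLinearMap ∘ₗ (match o with
      | none => LinearMap.prod 0 ι
      | some c => LinearMap.prod LinearMap.id (LinearMap.mulLeft (ZMod 2) c ∘ₗ ι))
  have gn : ∀ a, g none a = φ (0, ι a) := fun a => rfl
  have gs : ∀ c a, g (some c) a = φ (a, c * ι a) := fun c a => rfl
  have ginj : ∀ o, Function.Injective (g o) := by
    rintro (_ | c) a b h
    · rw [gn, gn] at h
      have := φ.injective h
      exact hι (Prod.ext_iff.mp this).2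
    · rw [gs, gs] at h
      have := φ.injective h
      exact (Prod.ext_iff.mp this).1
  have ι0 : ∀ a, ι a = 0 → a = 0 := fun a h => hι (by rw [h, map_zero])
  have gdis : ∀ o o', o ≠ o' → ∀ a b, g o a = g o' b → a = 0 := by
    rintro (_ | c) (_ | d) hne a b h
    · exact absurd rfl hne
    · rw [gn, gs] at h
      have := Prod.ext_iff.mp (φ.injective h)
      simp only at this
      apply ι0
      rw [this.2, ← this.1]; simp
    · rw [gn, gs] at h
      exact (Prod.ext_iff.mp (φ.injective h)).1
    · rw [gs, gs] at h
      have := Prod.ext_iff.mp (φ.injective h)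
      simp only at this
      obtain ⟨rfl, h2⟩ := this
      apply ι0
      by_contra h0
      exact hne (by rw [mul_right_cancel₀ h0 h2])
  have disj : ∀ o o', o ≠ o' → LinearMap.range (g o) ⊓ LinearMap.range (g o') = ⊥ := by
    intro o o' hne
    rw [eq_bot_iff]
    rintro v ⟨⟨a, rfl⟩, ⟨b, hb⟩⟩
    rw [gdis o o' hne a b hb.symm]
    simp
  have fr : ∀ o, Module.finrank (ZMod 2) (LinearMap.range (g o)) = k := by
    intro o
    rw [LinearMap.finrank_range_of_inj (ginj o), Module.finrank_fin_fun]
  have rinj : Function.Injective fun o => LinearMap.range (g o) := by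
    intro o o' h
    by_contra hne
    have h1 := disj o o' hne
    simp only at h
    rw [← h, inf_idem] at h1
    have h2 := fr o
    rw [h1, finrank_bot] at h2
    omega
  refine ⟨Finset.univ.image fun o => LinearMap.range (g o), ⟨?_, ?_⟩, ?_⟩
  · intro U hU
    obtain ⟨o, _, rfl⟩ := Finset.mem_image.mp hU
    exact fr o
  · intro U hU V hV hne
    obtain ⟨o, _, rfl⟩ := Finset.mem_image.mp hU
    obtain ⟨o', _, rfl⟩ := Finset.mem_image.mp hV
    exact disj o o' (fun h => hne (by rw [h]))
  · rw [Finset.card_image_of_injective _ rinj, Finset.card_univ, Fintype.card_option, cL]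

/-- For `k ≥ 4`, the maximum size of a partial `k`-spread in `𝔽_2^{2k+2}`
equals `2^{k+2} + 1`. -/
theorem partial_spread_max_2k2 (k : ℕ) (hk : 4 ≤ k) :
    IsGreatest {c : ℕ | ∃ S : Finset (Submodule (ZMod 2) (Fin (2 * k + 2) → ZMod 2)),
        IsPartialSpread k S ∧ S.card = c} (2 ^ (k + 2) + 1) := by
  refine ⟨exists_spread k hk, ?_⟩
  rintro c ⟨S, hS, rfl⟩
  by_contra! hcon
  obtain ⟨T, hTS, hT⟩ := Finset.exists_subset_card_eq (s := S) (n := 2 ^ (k + 2) + 2) (by omega)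
  exact no_big k hk T ⟨fun U hU => hS.1 U (hTS hU),
    fun U hU V hV h => hS.2 U (hTS hU) V (hTS hV) h⟩ hT
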